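/- arXiv:1509.06902 — 2 statements merged into one kernel-verified Lean document; each statement's English description precedes it below -/
import Mathlib

section
/- Let g > 0, (h,v1,v2,B1,B2) an SWMHD state with h > 0 and B1 ≠ 0, c = √(g h) and c_g = √(g h + B1²). With R̂ = [[1,0,1,0,1], [v1−c_g,0,v1,0,v1+c_g], [v2,1,v2,1,v2], [0,0,c_g²/B1,0,0], [B2,1,B2,−1,B2]] and the diagonal scaling matrix T = diag(c/(c_g√(2g)), c/√(2g), B1/(c_g√g), c/√(2g), c/(c_g√(2g))), the Merriam identity holds: (R̂ T)(R̂ T)ᵀ = R̂ (T²) R̂ᵀ = H, where H is the entropy Jacobian (1/g) · [[1, v1, v2, B1, B2], [v1, v1²+c², v1 v2, v1 B1, v1 B2], [v2, v1 v2, v2²+c², v2 B1, v2 B2], [B1, v1 B1, v2 B1, B1²+c², B1 B2], [B2, v1 B2, v2 B2, B1 B2, B2²+c²]]. -/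
open Matrix

noncomputable section

/-- Wave speed c = √(g h). -/
def ws (g h : ℝ) : ℝ := Real.sqrt (g * h)

/-- Magnetogravity wave speed c_g = √(g h + B1²). -/
def cg (g h B1 : ℝ) : ℝ := Real.sqrt (g * h + B1 ^ 2)

/-- Matrix of right eigenvectors R̂. -/
def Rhat (g h v1 v2 B1 B2 : ℝ) : Matrix (Fin 5) (Fin 5) ℝ :=
  !![1, 0, 1, 0, 1;
     v1 - cg g h B1, 0, v1, 0, v1 + cg g h B1;
     v2, 1, v2, 1, v2;
     0, 0, (cg g h B1) ^ 2 / B1, 0, 0;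
     B2, 1, B2, -1, B2]

/-- Diagonal scaling matrix T. -/
def Tmat (g h B1 : ℝ) : Matrix (Fin 5) (Fin 5) ℝ :=
  Matrix.diagonal
    ![ws g h / (cg g h B1 * Real.sqrt (2 * g)),
      ws g h / Real.sqrt (2 * g),
      B1 / (cg g h B1 * Real.sqrt g),
      ws g h / Real.sqrt (2 * g),
      ws g h / (cg g h B1 * Real.sqrt (2 * g))]

/-- Entropy Jacobian H (with c² = g h). -/
def entH (g h v1 v2 B1 B2 : ℝ) : Matrix (Fin 5) (Fin 5) ℝ :=
  (1 / g) • !![1, v1, v2, B1, B2;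
               v1, v1 ^ 2 + g * h, v1 * v2, v1 * B1, v1 * B2;
               v2, v1 * v2, v2 ^ 2 + g * h, v2 * B1, v2 * B2;
               B1, v1 * B1, v2 * B1, B1 ^ 2 + g * h, B1 * B2;
               B2, v1 * B2, v2 * B2, B1 * B2, B2 ^ 2 + g * h]

lemma cg_sq {g h : ℝ} (hg : 0 < g) (hh : 0 < h) (B1 : ℝ) :
    cg g h B1 ^ 2 = g * h + B1 ^ 2 :=
  Real.sq_sqrt (by positivity)

lemma cg_pos {g h : ℝ} (hg : 0 < g) (hh : 0 < h) (B1 : ℝ) : 0 < cg g h B1 :=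
  Real.sqrt_pos.2 (by positivity)

/-- The squared scaling matrix is free of square roots other than `c_g`. -/
lemma Tmat_mul_self {g h : ℝ} (hg : 0 < g) (hh : 0 < h) (B1 : ℝ) :
    Tmat g h B1 * Tmat g h B1 = Matrix.diagonal
      ![h / (2 * cg g h B1 ^ 2), h / 2, B1 ^ 2 / (cg g h B1 ^ 2 * g), h / 2,
        h / (2 * cg g h B1 ^ 2)] := by
  have hws : ws g h ^ 2 = g * h := Real.sq_sqrt (by positivity)
  have hsg : √g ^ 2 = g := Real.sq_sqrt hg.le
  have hcg := cg_pos hg hh B1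
  rw [Tmat, Matrix.diagonal_mul_diagonal]
  congr 1
  ext i
  fin_cases i <;> simp [← sq, div_pow, mul_pow, hws, hsg] <;> field_simp

lemma Rhat_mul_Tmat_sq_mul_transpose {g h B1 : ℝ} (v1 v2 B2 : ℝ)
    (hg : 0 < g) (hh : 0 < h) (hB1 : B1 ≠ 0) :
    Rhat g h v1 v2 B1 B2 * (Tmat g h B1 * Tmat g h B1) * (Rhat g h v1 v2 B1 B2)ᵀ =
      entH g h v1 v2 B1 B2 := by
  have hcg := cg_pos hg hh B1
  have hsq := cg_sq hg hh B1
  rw [Tmat_mul_self hg hh]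
  generalize hc : cg g h B1 = c at *
  have hh' : h = (c ^ 2 - B1 ^ 2) / g := by
    field_simp
    linarith
  ext i j
  rw [Matrix.mul_apply]
  simp only [Matrix.mul_diagonal, Matrix.transpose_apply, Fin.sum_univ_five, Rhat, entH, hc]
  clear hc hsq hh
  subst hh'
  fin_cases i <;> fin_cases j <;> simp <;> field_simp <;> ring

/-- Merriam identity: (R̂ T)(R̂ T)ᵀ = R̂ T² R̂ᵀ = H. -/
theorem merriam_identity (g h v1 v2 B1 B2 : ℝ)
    (hg : 0 < g) (hh : 0 < h) (hB1 : B1 ≠ 0) :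
    (Rhat g h v1 v2 B1 B2 * Tmat g h B1) * (Rhat g h v1 v2 B1 B2 * Tmat g h B1)ᵀ =
        entH g h v1 v2 B1 B2 ∧
      Rhat g h v1 v2 B1 B2 * (Tmat g h B1 * Tmat g h B1) * (Rhat g h v1 v2 B1 B2)ᵀ =
        entH g h v1 v2 B1 B2 := by
  have key := Rhat_mul_Tmat_sq_mul_transpose v1 v2 B2 hg hh hB1
  refine ⟨?_, key⟩
  have hT : (Tmat g h B1)ᵀ = Tmat g h B1 := Matrix.diagonal_transpose _
  rw [← key, Matrix.transpose_mul, hT]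
  simp only [Matrix.mul_assoc]
end
end

section
/- Let L, R be two SWMHD states with h_L, h_R > 0, g > 0, cell widths Δx_L, Δx_R > 0, {Δx B1} ≠ 0 and {Δx B2} ≠ 0, let λ ≥ 0 be any nonnegative real (representing |λ_max|), and let H be the entropy Jacobian evaluated at any SWMHD state with depth h > 0. Then the local Lax–Friedrichs type ES2 flux f^{ES2} = f^{ec} − ½ λ H ⟦q⟧ satisfies the entropy stability inequality ⟦q⟧ · f^{ES2} + 2 {Δx q} · s ≤ ½ g ⟦h² v1⟧ − ⟦h B1 (v1 B1 + v2 B2)⟧; in fact the difference of the two sides equals −½ λ ⟦q⟧ᵀ H ⟦q⟧ ≤ 0. -/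
open Matrix

noncomputable section

/-- Jump operator: ⟦a⟧ = a_R − a_L. -/
def jmp (l r : ℝ) : ℝ := r - l

/-- Average operator: {a} = (a_L + a_R)/2. -/
def avg (l r : ℝ) : ℝ := (l + r) / 2

/-- Entropy variables q = (g h − ½(v1²+v2²+B1²+B2²), v1, v2, B1, B2). -/
def qVec (g h v1 v2 B1 B2 : ℝ) : Fin 5 → ℝ :=
  ![g * h - (v1 ^ 2 + v2 ^ 2 + B1 ^ 2 + B2 ^ 2) / 2, v1, v2, B1, B2]

/-- Entropy conserving numerical flux f^{ec}. -/
def fec (g hL v1L v2L B1L B2L hR v1R v2R B1R B2R : ℝ) : Fin 5 → ℝ :=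
  ![avg hL hR * avg v1L v1R,
    avg hL hR * (avg v1L v1R) ^ 2 + g * avg (hL ^ 2) (hR ^ 2) / 2
      - avg (hL * B1L) (hR * B1R) * avg B1L B1R,
    avg hL hR * avg v1L v1R * avg v2L v2R - avg (hL * B1L) (hR * B1R) * avg B2L B2R,
    avg hL hR * avg v1L v1R * avg B1L B1R - avg (hL * B1L) (hR * B1R) * avg v1L v1R,
    avg hL hR * avg v1L v1R * avg B2L B2R - avg (hL * B1L) (hR * B1R) * avg v2L v2R]

/-- Interface source term s. -/
def srcTerm (ΔxL ΔxR hL v1L v2L B1L B2L hR v1R v2R B1R B2R : ℝ) : Fin 5 → ℝ :=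
  ![0, 0, 0,
    -(jmp (hL * B1L) (hR * B1R)) / 2 *
      (avg (v1L * B1L) (v1R * B1R) / avg (ΔxL * B1L) (ΔxR * B1R)),
    -(jmp (hL * B1L) (hR * B1R)) / 2 *
      (avg (v2L * B2L) (v2R * B2R) / avg (ΔxL * B2L) (ΔxR * B2R))]

/-- The flux `fec` together with the interface source term satisfies the discrete entropy
conservation identity. -/
lemma fec_entropy_conservation
    (g ΔxL ΔxR hL v1L v2L B1L B2L hR v1R v2R B1R B2R : ℝ)
    (hB1avg : avg (ΔxL * B1L) (ΔxR * B1R) ≠ 0)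
    (hB2avg : avg (ΔxL * B2L) (ΔxR * B2R) ≠ 0) :
    (fun i => jmp (qVec g hL v1L v2L B1L B2L i) (qVec g hR v1R v2R B1R B2R i)) ⬝ᵥ
          fec g hL v1L v2L B1L B2L hR v1R v2R B1R B2R
        + 2 * ((fun i => avg (ΔxL * qVec g hL v1L v2L B1L B2L i)
              (ΔxR * qVec g hR v1R v2R B1R B2R i)) ⬝ᵥ
            srcTerm ΔxL ΔxR hL v1L v2L B1L B2L hR v1R v2R B1R B2R)
      = g * jmp (hL ^ 2 * v1L) (hR ^ 2 * v1R) / 2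
          - jmp (hL * B1L * (v1L * B1L + v2L * B2L)) (hR * B1R * (v1R * B1R + v2R * B2R)) := by
  have hsrc : (fun i => avg (ΔxL * qVec g hL v1L v2L B1L B2L i)
              (ΔxR * qVec g hR v1R v2R B1R B2R i)) ⬝ᵥ
            srcTerm ΔxL ΔxR hL v1L v2L B1L B2L hR v1R v2R B1R B2R
      = -(jmp (hL * B1L) (hR * B1R)) / 2 *
          (avg (v1L * B1L) (v1R * B1R) + avg (v2L * B2L) (v2R * B2R)) := by
    simp only [dotProduct, Fin.sum_univ_five, qVec, srcTerm, cons_val, mul_zero, zero_add]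
    field_simp
    ring
  rw [hsrc]
  simp only [dotProduct, Fin.sum_univ_five, qVec, fec, cons_val, jmp, avg]
  ring

/-- The quadratic form of the entropy Jacobian as a sum of squares. -/
lemma dotProduct_entH_mulVec (g h v1 v2 B1 B2 : ℝ) (x : Fin 5 → ℝ) :
    x ⬝ᵥ (entH g h v1 v2 B1 B2).mulVec x
      = 1 / g * ((x 0 + v1 * x 1 + v2 * x 2 + B1 * x 3 + B2 * x 4) ^ 2
          + g * h * (x 1 ^ 2 + x 2 ^ 2 + x 3 ^ 2 + x 4 ^ 2)) := by
  simp only [entH, smul_mulVec, dotProduct_smul, smul_eq_mul]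
  simp only [dotProduct, mulVec, Fin.sum_univ_five, of_apply, cons_val]
  ring

lemma dotProduct_entH_mulVec_nonneg {g h : ℝ} (hg : 0 < g) (hh : 0 < h) (v1 v2 B1 B2 : ℝ)
    (x : Fin 5 → ℝ) : 0 ≤ x ⬝ᵥ (entH g h v1 v2 B1 B2).mulVec x := by
  rw [dotProduct_entH_mulVec]
  positivity

/-- Subtracting half of a scaled dissipation term splits off in the dot product. -/
lemma dotProduct_sub_mul_div_two {n : Type*} [Fintype n] (x f y : n → ℝ) (lam : ℝ) :
    x ⬝ᵥ (fun i => f i - lam * y i / 2) = x ⬝ᵥ f - lam * (x ⬝ᵥ y) / 2 := by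
  simp only [dotProduct, Finset.mul_sum, Finset.sum_div, ← Finset.sum_sub_distrib]
  exact Finset.sum_congr rfl fun i _ => by ring

/-- Entropy stability of the local Lax–Friedrichs type ES2 flux
f^{ES2} = f^{ec} − ½ λ H ⟦q⟧. -/
theorem ES2_entropy_stability
    (g ΔxL ΔxR hL v1L v2L B1L B2L hR v1R v2R B1R B2R h v1 v2 B1 B2 lam : ℝ)
    (hg : 0 < g) (hhL : 0 < hL) (hhR : 0 < hR)
    (hΔL : 0 < ΔxL) (hΔR : 0 < ΔxR)
    (hB1avg : avg (ΔxL * B1L) (ΔxR * B1R) ≠ 0)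
    (hB2avg : avg (ΔxL * B2L) (ΔxR * B2R) ≠ 0)
    (hh : 0 < h) (hlam : 0 ≤ lam) :
    (fun i => jmp (qVec g hL v1L v2L B1L B2L i) (qVec g hR v1R v2R B1R B2R i)) ⬝ᵥ
          (fun i => fec g hL v1L v2L B1L B2L hR v1R v2R B1R B2R i
            - lam * (entH g h v1 v2 B1 B2).mulVec
                (fun j => jmp (qVec g hL v1L v2L B1L B2L j) (qVec g hR v1R v2R B1R B2R j)) i / 2)
        + 2 * ((fun i => avg (ΔxL * qVec g hL v1L v2L B1L B2L i)
              (ΔxR * qVec g hR v1R v2R B1R B2R i)) ⬝ᵥ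
            srcTerm ΔxL ΔxR hL v1L v2L B1L B2L hR v1R v2R B1R B2R)
        - (g * jmp (hL ^ 2 * v1L) (hR ^ 2 * v1R) / 2
            - jmp (hL * B1L * (v1L * B1L + v2L * B2L)) (hR * B1R * (v1R * B1R + v2R * B2R)))
      = -(lam * ((fun i => jmp (qVec g hL v1L v2L B1L B2L i) (qVec g hR v1R v2R B1R B2R i)) ⬝ᵥ
            (entH g h v1 v2 B1 B2).mulVec
              (fun j => jmp (qVec g hL v1L v2L B1L B2L j) (qVec g hR v1R v2R B1R B2R j)))) / 2
    ∧
    (fun i => jmp (qVec g hL v1L v2L B1L B2L i) (qVec g hR v1R v2R B1R B2R i)) ⬝ᵥ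
          (fun i => fec g hL v1L v2L B1L B2L hR v1R v2R B1R B2R i
            - lam * (entH g h v1 v2 B1 B2).mulVec
                (fun j => jmp (qVec g hL v1L v2L B1L B2L j) (qVec g hR v1R v2R B1R B2R j)) i / 2)
        + 2 * ((fun i => avg (ΔxL * qVec g hL v1L v2L B1L B2L i)
              (ΔxR * qVec g hR v1R v2R B1R B2R i)) ⬝ᵥ
            srcTerm ΔxL ΔxR hL v1L v2L B1L B2L hR v1R v2R B1R B2R)
      ≤ g * jmp (hL ^ 2 * v1L) (hR ^ 2 * v1R) / 2
          - jmp (hL * B1L * (v1L * B1L + v2L * B2L)) (hR * B1R * (v1R * B1R + v2R * B2R)) := by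
  have hec := fec_entropy_conservation g ΔxL ΔxR hL v1L v2L B1L B2L hR v1R v2R B1R B2R
    hB1avg hB2avg
  have hH := mul_nonneg hlam (dotProduct_entH_mulVec_nonneg hg hh v1 v2 B1 B2
    (fun i => jmp (qVec g hL v1L v2L B1L B2L i) (qVec g hR v1R v2R B1R B2R i)))
  rw [dotProduct_sub_mul_div_two]
  constructor <;> linarith
end
end
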